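/- In the estimation-error setup, let x^1,…,x^T ∈ Δ^d be the iterates of OMWU with step size η > 0 run on the recovered estimated utilities û^1,…,û^T (with x^0 := x^1). Then the regret with respect to the true utilities satisfies: max_{x ∈ Δ^d} Σ_{t=1}^T ⟨u^t, x − x^t⟩ ≤ (log d)/η + 4η·Σ_{t=1}^T ‖u^t − u^{t−1}‖_∞² − (1/(8η))·Σ_{t=1}^T ‖x^t − x^{t−1}‖_1² + 2T‖Δ^T‖_∞ + 26η·Σ_{t=1}^{T−1} t²‖Δ^t‖_∞² + 4·Σ_{t=1}^T ε_t + 16π²η. -/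

import Mathlib

open Finset

lemma sum_range_succ_eq_sum_Icc {M : Type*} [AddCommMonoid M] (v : ℕ → M) (hv0 : v 0 = 0)
    (T : ℕ) : ∑ k ∈ range (T + 1), v k = ∑ k ∈ Icc 1 T, v k := by
  induction T with
  | zero => simp [hv0]
  | succ T ih => rw [sum_range_succ, ih, sum_Icc_succ_top (by lia)]

lemma sum_Icc_pred_le (g : ℕ → ℝ) (hg : ∀ t, 0 ≤ g t) (hg0 : g 0 = 0) (T : ℕ) :
    ∑ t ∈ Icc 1 T, g (t - 1) ≤ ∑ t ∈ Icc 1 T, g t := by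
  have h : ∑ t ∈ Icc 1 T, g (t - 1) = ∑ t ∈ range T, g t := by
    induction T with
    | zero => simp
    | succ T ih => rw [sum_range_succ, ← ih, sum_Icc_succ_top (by lia), Nat.add_sub_cancel]
  rw [h, ← sum_range_succ_eq_sum_Icc g hg0, sum_range_succ]
  linarith [hg T]

lemma sum_Icc_inv_sq_le (T : ℕ) : ∑ t ∈ Icc 1 T, (1 / (t : ℝ)) ^ 2 ≤ Real.pi ^ 2 / 6 := by
  simp only [div_pow, one_pow]
  exact sum_le_hasSum _ (fun _ _ => by positivity) hasSum_zeta_two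

section SoftMax

variable {ι : Type*} [Fintype ι]

/-- The log-sum-exp function. -/
noncomputable def logSumExp (a : ι → ℝ) : ℝ := Real.log (∑ i, Real.exp (a i))

/-- The softmax map, i.e. the gradient of `logSumExp`. -/
noncomputable def softmax (a : ι → ℝ) (i : ι) : ℝ := Real.exp (a i) / ∑ j, Real.exp (a j)

lemma sum_exp_pos [Nonempty ι] (a : ι → ℝ) : 0 < ∑ i, Real.exp (a i) :=
  sum_pos (fun _ _ => Real.exp_pos _) univ_nonempty

lemma softmax_nonneg (a : ι → ℝ) (i : ι) : 0 ≤ softmax a i := by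
  unfold softmax; positivity

lemma sum_softmax [Nonempty ι] (a : ι → ℝ) : ∑ i, softmax a i = 1 := by
  simp only [softmax, ← sum_div]
  exact div_self (sum_exp_pos a).ne'

lemma logSumExp_add [Nonempty ι] (a c : ι → ℝ) :
    logSumExp (a + c) = logSumExp a + Real.log (∑ i, softmax a i * Real.exp (c i)) := by
  have ha := sum_exp_pos a
  have hac := sum_exp_pos (a + c)
  have h : ∑ i, softmax a i * Real.exp (c i)
      = (∑ i, Real.exp ((a + c) i)) / ∑ i, Real.exp (a i) := by
    simp only [softmax, sum_div, Pi.add_apply, Real.exp_add, div_mul_eq_mul_div]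
  rw [h, Real.log_div hac.ne' ha.ne']
  simp [logSumExp]

open MeasureTheory ProbabilityTheory in
/-- **Hoeffding's lemma** for finitely supported distributions. -/
lemma sum_mul_exp_le_of_abs_le {p : ι → ℝ} (hp : ∀ i, 0 ≤ p i) (hp1 : ∑ i, p i = 1)
    {c : ι → ℝ} {s : ℝ} (hc : ∀ i, |c i| ≤ s) :
    ∑ i, p i * Real.exp (c i) ≤ Real.exp (∑ i, p i * c i + s ^ 2 / 2) := by
  let _ : MeasurableSpace ι := ⊤
  have hP1 : ∑ i, ENNReal.ofReal (p i) = 1 := by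
    rw [← ENNReal.ofReal_sum_of_nonneg fun i _ => hp i, hp1, ENNReal.ofReal_one]
  let P : PMF ι := PMF.ofFintype (fun i => ENNReal.ofReal (p i)) hP1
  have hint (f : ι → ℝ) : ∫ i, f i ∂P.toMeasure = ∑ i, p i * f i := by
    rw [PMF.integral_eq_sum]
    simp [P, ENNReal.toReal_ofReal (hp _)]
  have hH := (hasSubgaussianMGF_of_mem_Icc (μ := P.toMeasure) (X := c) (a := -s) (b := s)
    (measurable_from_top).aemeasurable (.of_forall fun i => abs_le.mp (hc i))).mgf_le 1
  rw [mgf, hint, hint] at hH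
  set m := ∑ i, p i * c i
  have hsum : ∑ i, p i * Real.exp (1 * (c i - m)) = (∑ i, p i * Real.exp (c i)) / Real.exp m := by
    simp only [one_mul, Real.exp_sub, sum_div, mul_div_assoc]
  have hss : (‖s - -s‖₊ / 2 : NNReal) ^ 2 = s ^ 2 := by
    push_cast
    rw [Real.norm_eq_abs, div_pow, sq_abs]
    ring
  rw [hsum, div_le_iff₀ (Real.exp_pos _), ← Real.exp_add] at hH
  refine hH.trans (Real.exp_le_exp.mpr ?_)
  push_cast at hss ⊢
  rw [hss]
  linarith

/-- `logSumExp` is `1`-smooth with respect to the sup-norm. -/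
lemma logSumExp_add_le [Nonempty ι] (a c : ι → ℝ) :
    logSumExp (a + c) ≤ logSumExp a + ∑ i, softmax a i * c i + ‖c‖ ^ 2 / 2 := by
  rw [logSumExp_add, add_assoc]
  gcongr
  have h := sum_mul_exp_le_of_abs_le (softmax_nonneg a) (sum_softmax a)
    (fun i => by simpa using norm_le_pi_norm c i : ∀ i, |c i| ≤ ‖c‖)
  refine (Real.log_le_log ?_ h).trans_eq (Real.log_exp _)
  have ha := sum_exp_pos a
  exact sum_pos (fun i _ => by unfold softmax; positivity) univ_nonempty

/-- `logSumExp` is convex, in gradient form. -/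
lemma le_logSumExp_add [Nonempty ι] (a c : ι → ℝ) :
    logSumExp a + ∑ i, softmax a i * c i ≤ logSumExp (a + c) := by
  rw [logSumExp_add]
  gcongr
  have h := convexOn_exp.map_sum_le (t := univ) (w := softmax a) (p := c)
    (fun i _ => softmax_nonneg a i) (sum_softmax a) (fun _ _ => Set.mem_univ _)
  simp only [smul_eq_mul] at h
  exact (Real.le_log_iff_exp_le ((Real.exp_pos _).trans_le h)).mpr h

/-- **Pinsker's inequality**, for softmax distributions. -/
lemma pinsker_softmax [Nonempty ι] (a c : ι → ℝ) :
    logSumExp a + ∑ i, softmax a i * c i + (∑ i, |softmax (a + c) i - softmax a i|) ^ 2 / 2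
      ≤ logSumExp (a + c) := by
  set s := ∑ i, |softmax (a + c) i - softmax a i| with hs
  have hs0 : 0 ≤ s := sum_nonneg fun _ _ => abs_nonneg _
  let h : ι → ℝ := fun i => s * SignType.sign (softmax a i - softmax (a + c) i)
  have hh : ‖h‖ ≤ s := by
    refine (pi_norm_le_iff_of_nonneg hs0).mpr fun i => ?_
    rw [Real.norm_eq_abs, abs_mul, abs_of_nonneg hs0]
    refine mul_le_of_le_one_right hs0 ?_
    rcases SignType.sign (softmax a i - softmax (a + c) i) with _ | _ | _ <;> simp
  have h1 := logSumExp_add_le (a + c) h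
  have h2 := le_logSumExp_add a (c + h)
  have h3 : ∑ i, (softmax a i - softmax (a + c) i) * h i = s ^ 2 := by
    rw [pow_two]
    nth_rewrite 2 [hs]
    rw [mul_sum]
    refine sum_congr rfl fun i _ => ?_
    rw [abs_sub_comm, ← self_mul_sign]
    ring
  simp only [sub_mul, sum_sub_distrib] at h3
  simp only [Pi.add_apply, mul_add, sum_add_distrib] at h2
  have h4 : ‖h‖ ^ 2 ≤ s ^ 2 := by gcongr
  rw [← add_assoc a c h] at h2
  linarith

/-- `softmax` is `1`-Lipschitz from the sup-norm to the `ℓ1`-norm. -/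
lemma sum_abs_softmax_sub_le [Nonempty ι] (a c : ι → ℝ) :
    ∑ i, |softmax (a + c) i - softmax a i| ≤ ‖c‖ := by
  have h1 := pinsker_softmax a c
  have h2 := logSumExp_add_le a c
  exact le_of_sq_le_sq (by linarith) (norm_nonneg _)

lemma sum_mul_le_logSumExp [Nonempty ι] (a : ι → ℝ) {y : ι → ℝ} (hy : ∀ i, 0 ≤ y i)
    (hy1 : ∑ i, y i = 1) : ∑ i, y i * a i ≤ logSumExp a := by
  have h (i : ι) : a i ≤ logSumExp a := by
    rw [logSumExp, Real.le_log_iff_exp_le (sum_exp_pos a)]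
    exact single_le_sum (f := fun i => Real.exp (a i)) (fun _ _ => (Real.exp_pos _).le)
      (mem_univ i)
  calc ∑ i, y i * a i ≤ ∑ i, y i * logSumExp a :=
        sum_le_sum fun i _ => mul_le_mul_of_nonneg_left (h i) (hy i)
    _ = logSumExp a := by rw [← sum_mul, hy1, one_mul]

lemma sum_mul_le_norm_mul (z b : ι → ℝ) : |∑ i, z i * b i| ≤ ‖z‖ * ∑ i, |b i| := by
  rw [mul_sum]
  refine (abs_sum_le_sum_abs _ _).trans (sum_le_sum fun i _ => ?_)
  rw [abs_mul]
  exact mul_le_mul_of_nonneg_right (norm_le_pi_norm z i) (abs_nonneg _)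

/-- The point played by optimistic multiplicative weights at time `t`. -/
noncomputable def omwu (η : ℝ) (v : ℕ → ι → ℝ) (t : ℕ) : ι → ℝ :=
  softmax (η • (∑ k ∈ range t, v k + v (t - 1)))

lemma omwu_potential_le [Nonempty ι] (η : ℝ) (v : ℕ → ι → ℝ) (hv0 : v 0 = 0) (T : ℕ) :
    logSumExp (η • ∑ k ∈ range (T + 1), v k)
        - η * ∑ t ∈ Icc 1 T, ∑ i, v t i * omwu η v t i
      ≤ Real.log (Fintype.card ι) + η ^ 2 * ∑ t ∈ Icc 1 T, ‖v t - v (t - 1)‖ ^ 2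
        - 1 / 4 * ∑ t ∈ Icc 1 T, (∑ i, |omwu η v t i - omwu η v (t - 1) i|) ^ 2
        - η ^ 2 * ‖v T - v (T - 1)‖ ^ 2 / 2 := by
  induction T with
  | zero => simp [hv0, logSumExp]
  | succ T ih =>
    simp only [sum_Icc_succ_top (show 1 ≤ T + 1 by lia), Nat.add_sub_cancel]
    set L : ι → ℝ := η • ∑ k ∈ range (T + 1), v k with hL
    set P : ι → ℝ := η • (∑ k ∈ range (T + 1), v k + v T) with hP
    have hx1 : omwu η v (T + 1) = softmax P := rfl
    have hL' : η • ∑ k ∈ range (T + 1 + 1), v k = P + η • (v (T + 1) - v T) := by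
      rw [sum_range_succ, hP, ← smul_add]
      congr 1
      abel
    have hLP : P + η • (-v T) = L := by
      rw [hP, hL, ← smul_add]
      congr 1
      abel
    have hg : L = η • (∑ k ∈ range T, v k + v (T - 1)) + η • (v T - v (T - 1)) := by
      rw [hL, sum_range_succ, ← smul_add]
      congr 1
      abel
    have h1 := logSumExp_add_le P (η • (v (T + 1) - v T))
    have h2 := pinsker_softmax P (η • (-v T))
    have h3 := sum_abs_softmax_sub_le (η • (∑ k ∈ range T, v k + v (T - 1)))
      (η • (v T - v (T - 1)))
    rw [← hL'] at h1
    rw [hLP] at h2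
    rw [← hg] at h3
    change ∑ i, |softmax L i - omwu η v T i| ≤ _ at h3
    rw [← hx1] at h1 h2
    set x1 := omwu η v (T + 1)
    set x0 := omwu η v T
    rw [norm_smul, mul_pow, Real.norm_eq_abs, sq_abs] at h1
    have h3' : (∑ i, |softmax L i - x0 i|) ^ 2 ≤ η ^ 2 * ‖v T - v (T - 1)‖ ^ 2 := by
      rw [norm_smul] at h3
      calc _ ≤ (‖η‖ * ‖v T - v (T - 1)‖) ^ 2 := by gcongr
        _ = _ := by rw [mul_pow, Real.norm_eq_abs, sq_abs]
    have h4 : (∑ i, |x1 i - x0 i|) ^ 2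
        ≤ 2 * (∑ i, |softmax L i - x1 i|) ^ 2 + 2 * (∑ i, |softmax L i - x0 i|) ^ 2 := by
      have : ∑ i, |x1 i - x0 i| ≤ ∑ i, |softmax L i - x1 i| + ∑ i, |softmax L i - x0 i| := by
        rw [← sum_add_distrib]
        refine sum_le_sum fun i _ => ?_
        rw [abs_sub_comm (softmax L i) (x1 i)]
        exact abs_sub_le _ _ _
      refine (pow_le_pow_left₀ (sum_nonneg fun _ _ => abs_nonneg _) this 2).trans ?_
      linarith [sq_nonneg (∑ i, |softmax L i - x1 i| - ∑ i, |softmax L i - x0 i|)]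
    have h5 : ∑ i, x1 i * (η • (v (T + 1) - v T)) i - ∑ i, x1 i * (η • (-v T)) i
        = η * ∑ i, v (T + 1) i * x1 i := by
      rw [← sum_sub_distrib, mul_sum]
      refine sum_congr rfl fun i _ => ?_
      simp only [Pi.smul_apply, Pi.sub_apply, Pi.neg_apply, smul_eq_mul]
      ring
    linarith

/-- The RVU (regret bounded by variation in utilities) bound for optimistic multiplicative
weights. -/
lemma omwu_regret_le [Nonempty ι] {η : ℝ} (hη : 0 < η) (v : ℕ → ι → ℝ) (hv0 : v 0 = 0) (T : ℕ)
    {y : ι → ℝ} (hy : y ∈ stdSimplex ℝ ι) :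
    ∑ t ∈ Icc 1 T, ∑ i, v t i * (y i - omwu η v t i)
      ≤ Real.log (Fintype.card ι) / η + η * ∑ t ∈ Icc 1 T, ‖v t - v (t - 1)‖ ^ 2
        - 1 / (4 * η) * ∑ t ∈ Icc 1 T, (∑ i, |omwu η v t i - omwu η v (t - 1) i|) ^ 2 := by
  have h1 := omwu_potential_le η v hv0 T
  have h2 := sum_mul_le_logSumExp (η • ∑ k ∈ range (T + 1), v k) hy.1 hy.2
  have h3 : ∑ i, y i * (η • ∑ k ∈ range (T + 1), v k) i
      = η * ∑ t ∈ Icc 1 T, ∑ i, v t i * y i := by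
    rw [sum_comm, mul_sum]
    refine sum_congr rfl fun i _ => ?_
    rw [Pi.smul_apply, sum_range_succ_eq_sum_Icc v hv0, Finset.sum_apply, smul_eq_mul, ← sum_mul]
    ring
  have h4 : 0 ≤ η ^ 2 * ‖v T - v (T - 1)‖ ^ 2 / 2 := by positivity
  simp only [mul_sub, sum_sub_distrib]
  rw [← mul_le_mul_iff_right₀ hη]
  have h5 : η * (Real.log (Fintype.card ι) / η + η * ∑ t ∈ Icc 1 T, ‖v t - v (t - 1)‖ ^ 2
        - 1 / (4 * η) * ∑ t ∈ Icc 1 T, (∑ i, |omwu η v t i - omwu η v (t - 1) i|) ^ 2)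
      = Real.log (Fintype.card ι) + η ^ 2 * ∑ t ∈ Icc 1 T, ‖v t - v (t - 1)‖ ^ 2
        - 1 / 4 * ∑ t ∈ Icc 1 T, (∑ i, |omwu η v t i - omwu η v (t - 1) i|) ^ 2 := by
    field_simp
  rw [h5]
  linarith

/-- The regret of optimistic multiplicative weights when it is run on the perturbed utilities
`u t + (Z t - Z (t - 1)) + f t` instead of `u t`. -/
lemma omwu_perturbed_regret_le [Nonempty ι] {η : ℝ} (hη : 0 < η) (T : ℕ) (u Z f v : ℕ → ι → ℝ)
    (hv : ∀ t, v t = u t + (Z t - Z (t - 1)) + f t) (hu0 : u 0 = 0) (hZ0 : Z 0 = 0)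
    (hZT : Z T = 0) (hf0 : f 0 = 0) (hf : ∀ t ∈ Icc 1 T, ‖f t‖ ≤ 1 / (t : ℝ))
    {y : ι → ℝ} (hy : y ∈ stdSimplex ℝ ι) :
    ∑ t ∈ Icc 1 T, ∑ i, u t i * (y i - omwu η v t i)
      ≤ Real.log (Fintype.card ι) / η
        + 4 * η * ∑ t ∈ Icc 1 T, ‖u t - u (t - 1)‖ ^ 2
        - 1 / (8 * η) * ∑ t ∈ Icc 1 T, (∑ i, |omwu η v t i - omwu η v (t - 1) i|) ^ 2
        + 26 * η * ∑ t ∈ Icc 1 T, ‖Z t‖ ^ 2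
        + 2 * ∑ t ∈ Icc 1 T, 1 / (t : ℝ)
        + 8 * Real.pi ^ 2 * η := by
  have hv0 : v 0 = 0 := by simp [hv, hu0, hf0]
  have hreg := omwu_regret_le hη v hv0 T hy
  have hvar : ∑ t ∈ Icc 1 T, ‖v t - v (t - 1)‖ ^ 2
      ≤ 4 * ∑ t ∈ Icc 1 T, ‖u t - u (t - 1)‖ ^ 2 + 24 * ∑ t ∈ Icc 1 T, ‖Z t‖ ^ 2
        + 8 * Real.pi ^ 2 := by
    have hterm (t : ℕ) : ‖v t - v (t - 1)‖ ^ 2 ≤ 4 * ‖u t - u (t - 1)‖ ^ 2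
        + 6 * (‖Z t‖ ^ 2 + 2 * ‖Z (t - 1)‖ ^ 2 + ‖Z (t - 1 - 1)‖ ^ 2)
        + 24 * (‖f t‖ ^ 2 + ‖f (t - 1)‖ ^ 2) := by
      have h1 : ‖v t - v (t - 1)‖ ≤ ‖u t - u (t - 1)‖
          + (‖Z t‖ + 2 * ‖Z (t - 1)‖ + ‖Z (t - 1 - 1)‖) + (‖f t‖ + ‖f (t - 1)‖) := by
        have h : v t - v (t - 1) = (u t - u (t - 1))
            + ((Z t - Z (t - 1)) - (Z (t - 1) - Z (t - 1 - 1))) + (f t - f (t - 1)) := by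
          rw [hv, hv]
          abel
        rw [h]
        linarith [norm_add₃_le (a := u t - u (t - 1))
            (b := (Z t - Z (t - 1)) - (Z (t - 1) - Z (t - 1 - 1))) (c := f t - f (t - 1)),
          norm_sub_le (Z t - Z (t - 1)) (Z (t - 1) - Z (t - 1 - 1)),
          norm_sub_le (Z t) (Z (t - 1)), norm_sub_le (Z (t - 1)) (Z (t - 1 - 1)),
          norm_sub_le (f t) (f (t - 1))]
      have h2 (A P Q : ℝ) : (A + P + Q) ^ 2 ≤ 4 * A ^ 2 + 3 / 2 * P ^ 2 + 12 * Q ^ 2 := by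
        nlinarith [sq_nonneg (3 * P - 8 * A), sq_nonneg (A - 3 * Q), sq_nonneg (P - 8 * Q)]
      have h3 (p q r : ℝ) : (p + 2 * q + r) ^ 2 ≤ 4 * (p ^ 2 + 2 * q ^ 2 + r ^ 2) := by
        nlinarith [sq_nonneg (p - q), sq_nonneg (p - r), sq_nonneg (q - r)]
      refine (pow_le_pow_left₀ (norm_nonneg _) h1 2).trans ((h2 _ _ _).trans ?_)
      linarith [h3 ‖Z t‖ ‖Z (t - 1)‖ ‖Z (t - 1 - 1)‖, sq_nonneg (‖f t‖ - ‖f (t - 1)‖)]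
    have hsum := sum_le_sum fun t (_ : t ∈ Icc 1 T) => hterm t
    simp only [sum_add_distrib, ← mul_sum] at hsum
    have hZ1 := sum_Icc_pred_le (fun t => ‖Z t‖ ^ 2) (fun _ => by positivity) (by simp [hZ0]) T
    have hZ2 := sum_Icc_pred_le (fun t => ‖Z (t - 1)‖ ^ 2) (fun _ => by positivity)
      (by simp [hZ0]) T
    have hf1 := sum_Icc_pred_le (fun t => ‖f t‖ ^ 2) (fun _ => by positivity) (by simp [hf0]) T
    have hf2 : ∑ t ∈ Icc 1 T, ‖f t‖ ^ 2 ≤ Real.pi ^ 2 / 6 :=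
      (sum_le_sum fun t ht => pow_le_pow_left₀ (norm_nonneg _) (hf t ht) 2).trans
        (sum_Icc_inv_sq_le T)
    linarith
  have hsplit (n : ℕ) : ∑ t ∈ Icc 1 n, ∑ i, u t i * (y i - omwu η v t i)
      = ∑ t ∈ Icc 1 n, ∑ i, v t i * (y i - omwu η v t i)
        - ∑ t ∈ Icc 1 n, ∑ i, f t i * (y i - omwu η v t i)
        - ∑ t ∈ Icc 1 n, ∑ i, Z (t - 1) i * (omwu η v t i - omwu η v (t - 1) i)
        - ∑ i, Z n i * (y i - omwu η v n i) := by
    induction n with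
    | zero => simp [hZ0]
    | succ n ih =>
      simp only [sum_Icc_succ_top (show 1 ≤ n + 1 by lia), Nat.add_sub_cancel]
      rw [ih]
      have h : ∑ i, u (n + 1) i * (y i - omwu η v (n + 1) i)
          = ∑ i, v (n + 1) i * (y i - omwu η v (n + 1) i)
            - ∑ i, f (n + 1) i * (y i - omwu η v (n + 1) i)
            - ∑ i, Z n i * (omwu η v (n + 1) i - omwu η v n i)
            - ∑ i, Z (n + 1) i * (y i - omwu η v (n + 1) i)
            + ∑ i, Z n i * (y i - omwu η v n i) := by
        simp only [← sum_sub_distrib, ← sum_add_distrib]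
        refine sum_congr rfl fun i _ => ?_
        simp only [hv (n + 1), Pi.add_apply, Pi.sub_apply, Nat.add_sub_cancel]
        ring
      rw [h]
      ring
  have hfbound : -∑ t ∈ Icc 1 T, ∑ i, f t i * (y i - omwu η v t i)
      ≤ 2 * ∑ t ∈ Icc 1 T, 1 / (t : ℝ) := by
    rw [← sum_neg_distrib, mul_sum]
    refine sum_le_sum fun t ht => ?_
    have h2 : ∑ i, |y i - omwu η v t i| ≤ 2 := by
      calc ∑ i, |y i - omwu η v t i| ≤ ∑ i, (y i + omwu η v t i) := by
            refine sum_le_sum fun i _ => (abs_sub _ _).trans_eq ?_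
            rw [abs_of_nonneg (hy.1 i), abs_of_nonneg (a := omwu η v t i) (softmax_nonneg _ i)]
        _ = 2 := by
            rw [sum_add_distrib, hy.2, omwu, sum_softmax]
            norm_num
    calc _ ≤ ‖f t‖ * ∑ i, |y i - omwu η v t i| :=
          (neg_le_abs _).trans (sum_mul_le_norm_mul (f t) fun i => y i - omwu η v t i)
      _ ≤ 1 / (t : ℝ) * 2 := by
          gcongr
          exact hf t ht
      _ = _ := mul_comm _ _
  have hZbound : -∑ t ∈ Icc 1 T, ∑ i, Z (t - 1) i * (omwu η v t i - omwu η v (t - 1) i)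
      ≤ 2 * η * ∑ t ∈ Icc 1 T, ‖Z t‖ ^ 2
        + 1 / (8 * η) * ∑ t ∈ Icc 1 T, (∑ i, |omwu η v t i - omwu η v (t - 1) i|) ^ 2 := by
    have hZ1 := sum_Icc_pred_le (fun t => ‖Z t‖ ^ 2) (fun _ => by positivity) (by simp [hZ0]) T
    refine le_trans ?_ (add_le_add_left (mul_le_mul_of_nonneg_left hZ1 (by positivity)) _)
    rw [← sum_neg_distrib, mul_sum, mul_sum, ← sum_add_distrib]
    refine sum_le_sum fun t _ => ?_
    refine (neg_le_abs _).trans ((sum_mul_le_norm_mul (Z (t - 1))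
      fun i => omwu η v t i - omwu η v (t - 1) i).trans ?_)
    generalize ∑ i, |omwu η v t i - omwu η v (t - 1) i| = b
    generalize ‖Z (t - 1)‖ = a
    have h : 2 * η * a ^ 2 + 1 / (8 * η) * b ^ 2 - a * b = (4 * η * a - b) ^ 2 / (8 * η) := by
      field_simp
      ring
    have : 0 ≤ (4 * η * a - b) ^ 2 / (8 * η) := by positivity
    linarith
  have h8 : 1 / (4 * η) * ∑ t ∈ Icc 1 T, (∑ i, |omwu η v t i - omwu η v (t - 1) i|) ^ 2
      = 2 * (1 / (8 * η) * ∑ t ∈ Icc 1 T, (∑ i, |omwu η v t i - omwu η v (t - 1) i|) ^ 2) := by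
    field_simp
    ring
  have hvar' := mul_le_mul_of_nonneg_left hvar hη.le
  have hT := hsplit T
  simp only [hZT, Pi.zero_apply, zero_mul, sum_const_zero, sub_zero] at hT
  linarith

end SoftMax

lemma abs_average_sub_average_le (u : ℕ → ℝ) (n : ℕ) (hn : 1 ≤ n)
    (hu : ∀ t ∈ Icc 1 (n + 1), u t ∈ Set.Icc (0 : ℝ) 1) :
    |1 / (n : ℝ) * ∑ k ∈ Icc 1 n, u k - 1 / ((n + 1 : ℕ) : ℝ) * ∑ k ∈ Icc 1 (n + 1), u k|
      ≤ 1 / ((n + 1 : ℕ) : ℝ) := by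
  have hn0 : (0 : ℝ) < n := by exact_mod_cast hn
  have hS0 : 0 ≤ ∑ k ∈ Icc 1 n, u k :=
    sum_nonneg fun k hk => (hu k (Icc_subset_Icc_right (by lia) hk)).1
  have hS1 : ∑ k ∈ Icc 1 n, u k ≤ n := by
    refine (sum_le_sum fun k hk => (hu k (Icc_subset_Icc_right (by lia) hk)).2).trans_eq ?_
    simp
  obtain ⟨h0, h1⟩ := hu (n + 1) (by simp)
  rw [sum_Icc_succ_top (by lia)]
  generalize ∑ k ∈ Icc 1 n, u k = S at *
  have h : 1 / (n : ℝ) * S - 1 / ((n + 1 : ℕ) : ℝ) * (S + u (n + 1))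
      = (S / n - u (n + 1)) * (1 / ((n + 1 : ℕ) : ℝ)) := by
    push_cast
    field_simp
    ring
  have hS0' : 0 ≤ S / n := by positivity
  have hS1' : S / n ≤ 1 := (div_le_one hn0).mpr hS1
  rw [h, abs_mul, abs_of_nonneg (a := 1 / ((n + 1 : ℕ) : ℝ)) (by positivity)]
  exact mul_le_of_le_one_left (by positivity) (abs_le.mpr ⟨by linarith, by linarith⟩)

/-- regret of OMWU run on the recovered estimated utilities `û^t`, measured against
the true utilities `u^t`, in the estimation-error setup (`ε_t = 1/t`,
`ū^t_ε = (1−ε_t)·(1/t)∑_{k≤t} u^k + ε_t·w`, `Δ^t = Û^t − ū^t_ε`, `û^t = t·Û^t − (t−1)·Û^{t−1}`).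
`‖·‖` on `Fin d → ℝ` is the sup-norm; the ℓ1-norm is written explicitly. -/
theorem stmt9 (d T : ℕ) (hd : 1 ≤ d) (hT : 1 ≤ T)
    (η : ℝ) (hη : 0 < η)
    (u : ℕ → Fin d → ℝ) (hu0 : u 0 = 0)
    (hu : ∀ t ∈ Finset.Icc 1 T, ∀ a, u t a ∈ Set.Icc (0 : ℝ) 1)
    (w : Fin d → ℝ) (hw : ∀ a, w a ∈ Set.Icc (0 : ℝ) 1)
    (Uhat : ℕ → Fin d → ℝ) (hUhat0 : Uhat 0 = 0)
    (Δ : ℕ → Fin d → ℝ) (hΔ0 : Δ 0 = 0)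
    (hΔ : ∀ t ∈ Finset.Icc 1 T, ∀ a, Δ t a =
      Uhat t a - ((1 - 1 / (t : ℝ)) * ((1 / (t : ℝ)) * ∑ k ∈ Finset.Icc 1 t, u k a)
        + (1 / (t : ℝ)) * w a))
    (uhat : ℕ → Fin d → ℝ)
    (huhat : ∀ t a, uhat t a = (t : ℝ) * Uhat t a - ((t - 1 : ℕ) : ℝ) * Uhat (t - 1) a)
    (x : ℕ → Fin d → ℝ) (hx0 : x 0 = x 1)
    (hx : ∀ t, 1 ≤ t → t ≤ T → ∀ a, x t a =
      Real.exp (η * ((∑ k ∈ Finset.range t, uhat k a) + uhat (t - 1) a)) /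
        ∑ b, Real.exp (η * ((∑ k ∈ Finset.range t, uhat k b) + uhat (t - 1) b))) :
    (⨆ y : stdSimplex ℝ (Fin d),
        ∑ t ∈ Finset.Icc 1 T, ∑ a, u t a * ((y : Fin d → ℝ) a - x t a)) ≤
      Real.log d / η
        + 4 * η * ∑ t ∈ Finset.Icc 1 T, ‖u t - u (t - 1)‖ ^ 2
        - (1 / (8 * η)) * ∑ t ∈ Finset.Icc 1 T, (∑ a, |x t a - x (t - 1) a|) ^ 2
        + 2 * (T : ℝ) * ‖Δ T‖
        + 26 * η * ∑ t ∈ Finset.Icc 1 (T - 1), (t : ℝ) ^ 2 * ‖Δ t‖ ^ 2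
        + 4 * ∑ t ∈ Finset.Icc 1 T, (1 / (t : ℝ))
        + 16 * Real.pi ^ 2 * η := by
  have : Nonempty (Fin d) := ⟨⟨0, hd⟩⟩
  let E : ℕ → Fin d → ℝ := fun t a =>
    if t = 0 then 0 else w a - 1 / (t : ℝ) * ∑ k ∈ Finset.Icc 1 t, u k a
  let Z : ℕ → Fin d → ℝ := fun t => if t < T then (t : ℝ) • Δ t else 0
  let f : ℕ → Fin d → ℝ := fun t => E t - E (t - 1)
  let v : ℕ → Fin d → ℝ := fun t => u t + (Z t - Z (t - 1)) + f t
  have hf : ∀ t ∈ Finset.Icc 1 T, ‖f t‖ ≤ 1 / (t : ℝ) := by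
    intro t ht
    refine (pi_norm_le_iff_of_nonneg (by positivity)).mpr fun a => ?_
    obtain ⟨ht1, htT⟩ := Finset.mem_Icc.mp ht
    obtain ⟨n, rfl⟩ := Nat.exists_eq_add_of_le' ht1
    rcases Nat.eq_zero_or_pos n with rfl | hn
    · have h1 := hu 1 ht a
      have h2 := hw a
      simp only [f, E, Pi.sub_apply, Real.norm_eq_abs]
      simp only [Set.mem_Icc] at h1 h2
      norm_num
      exact abs_le.mpr ⟨by linarith, by linarith⟩
    · have h := abs_average_sub_average_le (fun k => u k a) n hn
        fun k hk => hu k (Finset.Icc_subset_Icc_right htT hk) a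
      simp only [f, E, Pi.sub_apply, Real.norm_eq_abs, Nat.add_sub_cancel, hn.ne', if_false,
        Nat.succ_ne_zero]
      rwa [sub_sub_sub_cancel_left]
  have hcum : ∀ t, t < T → ∀ a,
      (t : ℝ) * Uhat t a = Z t a + ∑ k ∈ Finset.Icc 1 t, u k a + E t a := by
    intro t ht a
    rcases Nat.eq_zero_or_pos t with rfl | h0
    · simp [Z, E]
    · have h := hΔ t (Finset.mem_Icc.mpr ⟨h0, ht.le⟩) a
      have ht0 : (t : ℝ) ≠ 0 := by positivity
      simp only [Z, E, ht, if_true, h0.ne', if_false, Pi.smul_apply, smul_eq_mul, h]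
      field_simp
      ring
  have hv : ∀ t, t < T → v t = uhat t := by
    intro t ht
    ext a
    rcases Nat.eq_zero_or_pos t with rfl | h0
    · simp [v, f, hu0, huhat]
    · obtain ⟨n, rfl⟩ := Nat.exists_eq_add_of_le' h0
      rw [huhat, hcum _ ht, hcum _ (by lia), Finset.sum_Icc_succ_top (by lia)]
      simp only [v, f, Pi.add_apply, Pi.sub_apply, Nat.add_sub_cancel]
      ring
  have hx_omwu : ∀ t, 1 ≤ t → t ≤ T → x t = omwu η v t := by
    intro t h1 hT
    ext a
    have hsum : ∑ k ∈ Finset.range t, v k = ∑ k ∈ Finset.range t, uhat k :=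
      Finset.sum_congr rfl fun k hk => hv k (by have := Finset.mem_range.mp hk; lia)
    rw [hx t h1 hT, omwu, hsum, hv (t - 1) (by lia)]
    simp [softmax]
  have hx_omwu0 : x 0 = omwu η v 0 := by
    rw [hx0, hx_omwu 1 le_rfl hT]
    simp [omwu, v, f, hu0]
  have hx_all : ∀ t, t ≤ T → x t = omwu η v t := by
    intro t ht
    rcases Nat.eq_zero_or_pos t with rfl | h0
    exacts [hx_omwu0, hx_omwu t h0 ht]
  have hZ : ∑ t ∈ Finset.Icc 1 T, ‖Z t‖ ^ 2
      = ∑ t ∈ Finset.Icc 1 (T - 1), (t : ℝ) ^ 2 * ‖Δ t‖ ^ 2 := by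
    obtain ⟨n, rfl⟩ := Nat.exists_eq_add_of_le' hT
    rw [Finset.sum_Icc_succ_top (by lia), Nat.add_sub_cancel]
    simp only [Z, lt_irrefl, if_false, norm_zero, ne_eq, OfNat.ofNat_ne_zero, not_false_eq_true,
      zero_pow, add_zero]
    refine Finset.sum_congr rfl fun t ht => ?_
    rw [if_pos (by have := Finset.mem_Icc.mp ht; lia), norm_smul, mul_pow, Real.norm_natCast]
  have : Nonempty (stdSimplex ℝ (Fin d)) := ⟨⟨_, single_mem_stdSimplex ℝ ⟨0, hd⟩⟩⟩
  refine ciSup_le fun y => ?_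
  have hmain := omwu_perturbed_regret_le hη T u Z f v (fun _ => rfl) hu0 (by simp [Z])
    (by simp [Z]) (by simp [f]) hf y.2
  rw [hZ, Fintype.card_fin] at hmain
  have hx1 : ∑ t ∈ Finset.Icc 1 T, ∑ a, u t a * ((y : Fin d → ℝ) a - x t a)
      = ∑ t ∈ Finset.Icc 1 T, ∑ a, u t a * ((y : Fin d → ℝ) a - omwu η v t a) :=
    Finset.sum_congr rfl fun t ht => by rw [hx_all t (Finset.mem_Icc.mp ht).2]
  have hx2 : ∑ t ∈ Finset.Icc 1 T, (∑ a, |x t a - x (t - 1) a|) ^ 2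
      = ∑ t ∈ Finset.Icc 1 T, (∑ a, |omwu η v t a - omwu η v (t - 1) a|) ^ 2 :=
    Finset.sum_congr rfl fun t ht => by
      have := (Finset.mem_Icc.mp ht).2
      rw [hx_all t this, hx_all (t - 1) (by lia)]
  rw [hx1, hx2]
  have h1 : 0 ≤ ∑ t ∈ Finset.Icc 1 T, 1 / (t : ℝ) := Finset.sum_nonneg fun _ _ => by positivity
  have h2 : 0 ≤ 2 * (T : ℝ) * ‖Δ T‖ := by positivity
  have h3 : 0 ≤ Real.pi ^ 2 * η := by positivity
  refine hmain.trans ?_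
  linarith
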